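/- Let α > 0 be a noninteger real number, n = ⌊α⌋ + 1, a ∈ ℤ, f : ℤ → ℝ, and t ∈ ℤ with t ≥ a + 1. Then (i) (∇_a^{α}(∇_a^{−α} f))(t) = f(t), and (ii) (∇_a^{−α}(∇_a^{α} f))(t) = f(t); that is, the nabla left Riemann fractional difference and the nabla left fractional sum of the same noninteger order α are two-sided inverses on {a+1, a+2, …}. -/

import Mathlib

/-- Backward difference operator: `(∇ f)(t) = f t − f (t−1)`. -/
def nablaOp (f : ℤ → ℝ) : ℤ → ℝ := fun t => f t - f (t - 1)

/-- Forward difference operator: `(Δ f)(t) = f (t+1) − f t`. -/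
def deltaOp (f : ℤ → ℝ) : ℤ → ℝ := fun t => f (t + 1) - f t

/-- The operator `−Δ`. -/
def negDeltaOp (f : ℤ → ℝ) : ℤ → ℝ := fun t => -(f (t + 1) - f t)

/-- Nabla left fractional sum of order `α` starting at `a`:
`(∇_a^{-α} f)(t) = (1/Γ(α)) Σ_{s=a+1}^{t} [Γ(t−s+α)/Γ(t−s+1)] f(s)`. -/
noncomputable def nablaLeftSum (a : ℤ) (α : ℝ) (f : ℤ → ℝ) : ℤ → ℝ := fun t =>
  (1 / Real.Gamma α) * ∑ s ∈ Finset.Icc (a + 1) t,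
    (Real.Gamma ((t : ℝ) - (s : ℝ) + α) / Real.Gamma ((t : ℝ) - (s : ℝ) + 1)) * f s

/-- Nabla right fractional sum of order `α` ending at `b`:
`(_b∇^{-α} f)(t) = (1/Γ(α)) Σ_{s=t}^{b−1} [Γ(s−t+α)/Γ(s−t+1)] f(s)`. -/
noncomputable def nablaRightSum (b : ℤ) (α : ℝ) (f : ℤ → ℝ) : ℤ → ℝ := fun t =>
  (1 / Real.Gamma α) * ∑ s ∈ Finset.Icc t (b - 1),
    (Real.Gamma ((s : ℝ) - (t : ℝ) + α) / Real.Gamma ((s : ℝ) - (t : ℝ) + 1)) * f s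

open PowerSeries in
/-- The generating series `∑ k, f (a + 1 + k) X ^ k` of the values of `f` on `{a + 1, a + 2, …}`. -/
noncomputable def genSeries (a : ℤ) (f : ℤ → ℝ) : PowerSeries ℝ :=
  mk fun k => f (a + 1 + k)

open PowerSeries in
/-- The power series of `(1 - X) ^ (-α)`. -/
noncomputable def nablaKernel (α : ℝ) : PowerSeries ℝ :=
  rescale (-1) (binomialSeries ℝ (-α))

lemma nablaKernel_add (α β : ℝ) : nablaKernel (α + β) = nablaKernel α * nablaKernel β := by
  rw [nablaKernel, neg_add, PowerSeries.binomialSeries_add, map_mul, nablaKernel, nablaKernel]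

lemma nablaKernel_neg_natCast (n : ℕ) : nablaKernel (-n) = (1 - PowerSeries.X) ^ n := by
  rw [nablaKernel, neg_neg, PowerSeries.binomialSeries_nat, map_pow, map_add, map_one,
    PowerSeries.rescale_neg_one_X, sub_eq_add_neg]

lemma nablaKernel_zero : nablaKernel 0 = 1 := by
  simpa using nablaKernel_neg_natCast 0

lemma coeff_nablaKernel (α : ℝ) (k : ℕ) :
    PowerSeries.coeff k (nablaKernel α) = Ring.multichoose α k := by
  rw [nablaKernel, PowerSeries.coeff_rescale, PowerSeries.binomialSeries_coeff, Ring.choose_neg',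
    Units.smul_def, zsmul_eq_mul, Int.cast_negOnePow_natCast, smul_eq_mul, mul_one, ← mul_assoc,
    ← mul_pow, neg_one_mul, neg_neg, one_pow, one_mul]

lemma Gamma_nat_add {α : ℝ} (hα : 0 < α) (k : ℕ) :
    Real.Gamma (k + α) = (k.factorial * Ring.multichoose α k) * Real.Gamma α := by
  rw [← nsmul_eq_mul, Ring.factorial_nsmul_multichoose_eq_ascPochhammer,
    Polynomial.ascPochhammer_smeval_eq_eval]
  induction k with
  | zero => simp
  | succ k ih =>
    rw [Nat.cast_succ, add_right_comm, Real.Gamma_add_one (by positivity), ih,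
      ascPochhammer_succ_eval]
    ring

lemma nablaLeftSum_eq_zero (a : ℤ) (α : ℝ) (f : ℤ → ℝ) {t : ℤ} (ht : t ≤ a) :
    nablaLeftSum a α f t = 0 := by
  rw [nablaLeftSum, Finset.Icc_eq_empty (by omega), Finset.sum_empty, mul_zero]

lemma genSeries_nablaLeftSum (a : ℤ) {α : ℝ} (hα : 0 < α) (f : ℤ → ℝ) :
    genSeries a (nablaLeftSum a α f) = nablaKernel α * genSeries a f := by
  ext k
  rw [PowerSeries.coeff_mul, genSeries, PowerSeries.coeff_mk, nablaLeftSum, Finset.mul_sum]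
  symm
  refine Finset.sum_bij' (fun p _ => a + 1 + p.2)
    (fun s _ => ((a + 1 + k - s).toNat, (s - (a + 1)).toNat)) ?_ ?_ ?_ ?_ ?_
  · rintro ⟨i, j⟩ h
    simp only [Finset.HasAntidiagonal.mem_antidiagonal, Finset.mem_Icc] at h ⊢
    omega
  · intro s h
    simp only [Finset.HasAntidiagonal.mem_antidiagonal, Finset.mem_Icc] at h ⊢
    omega
  · rintro ⟨i, j⟩ h
    simp only [Finset.HasAntidiagonal.mem_antidiagonal, Prod.mk.injEq] at h ⊢
    omega
  · intro s h
    simp only [Finset.mem_Icc] at h ⊢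
    omega
  · rintro ⟨i, j⟩ h
    rw [Finset.HasAntidiagonal.mem_antidiagonal] at h
    subst h
    have hi : (((a + 1 + ((i + j : ℕ) : ℤ) : ℤ) : ℝ) - ((a + 1 + (j : ℤ) : ℤ) : ℝ)) = i := by
      push_cast
      ring
    have hΓ := (Real.Gamma_pos_of_pos hα).ne'
    have hk : (i.factorial : ℝ) ≠ 0 := by positivity
    rw [coeff_nablaKernel, genSeries, PowerSeries.coeff_mk, hi, Gamma_nat_add hα,
      Real.Gamma_nat_eq_factorial]
    field_simp

lemma genSeries_nablaOp_iterate (n : ℕ) {a : ℤ} {g : ℤ → ℝ} (hg : ∀ t ≤ a, g t = 0) :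
    genSeries a (nablaOp^[n] g) = (1 - PowerSeries.X) ^ n * genSeries a g := by
  induction n generalizing g with
  | zero => simp
  | succ n ih =>
    rw [Function.iterate_succ_apply, ih, pow_succ, mul_assoc]
    · congr 1
      ext k
      rw [sub_mul, one_mul, map_sub]
      cases k with
      | zero => simp [genSeries, nablaOp, hg a le_rfl]
      | succ k =>
        rw [PowerSeries.coeff_succ_X_mul]
        simp only [genSeries, PowerSeries.coeff_mk, nablaOp]
        congr 2
        push_cast
        ring
    · intro t ht
      rw [nablaOp, hg t ht, hg (t - 1) (by omega), sub_zero]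

lemma eq_of_genSeries_eq {a : ℤ} {f g : ℤ → ℝ} (h : genSeries a f = genSeries a g) {t : ℤ}
    (ht : a + 1 ≤ t) : f t = g t := by
  obtain ⟨k, rfl⟩ := Int.le.dest ht
  simpa [genSeries] using congrArg (PowerSeries.coeff k) h

theorem stmt15 (α : ℝ) (hα : 0 < α) (hαni : ∀ m : ℤ, α ≠ (m : ℝ)) (n : ℕ)
    (hn : (n : ℤ) = ⌊α⌋ + 1) (a : ℤ) (f : ℤ → ℝ) (t : ℤ) (ht : a + 1 ≤ t) :
    nablaOp^[n] (nablaLeftSum a ((n : ℝ) - α) (nablaLeftSum a α f)) t = f t ∧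
      nablaLeftSum a α (fun s => nablaOp^[n] (nablaLeftSum a ((n : ℝ) - α) f) s) t = f t := by
  have hβ : 0 < (n : ℝ) - α := by
    have h : (n : ℝ) = ⌊α⌋ + 1 := by exact_mod_cast hn
    rw [h, sub_pos]
    exact Int.lt_floor_add_one α
  have hker : nablaKernel (-n) * nablaKernel (n - α) * nablaKernel α = 1 := by
    rw [← nablaKernel_add, ← nablaKernel_add, ← nablaKernel_zero]
    congr 1
    ring
  constructor <;> refine eq_of_genSeries_eq ?_ ht
  · rw [genSeries_nablaOp_iterate n fun _ => nablaLeftSum_eq_zero _ _ _,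
      genSeries_nablaLeftSum a hβ, genSeries_nablaLeftSum a hα, ← nablaKernel_neg_natCast,
      ← mul_assoc, ← mul_assoc, hker, one_mul]
  · rw [genSeries_nablaLeftSum a hα,
      genSeries_nablaOp_iterate n fun _ => nablaLeftSum_eq_zero _ _ _,
      genSeries_nablaLeftSum a hβ, ← nablaKernel_neg_natCast, ← mul_assoc, ← mul_assoc,
      mul_assoc (nablaKernel α), mul_comm (nablaKernel α), hker, one_mul]
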